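/- arXiv:1003.4317 — 2 statements merged into one kernel-verified Lean document; each statement's English description precedes it below -/
import Mathlib

section
/- Let n ≥ 1, let E be a real vector space, and let φ ∈ E ⊗[ℝ] A_n satisfy (id_E ⊗ ε_j) φ = (id_E ⊗ ε_•) φ for every j : Fin n. Then there exists a unique ψ ∈ E ⊗[ℝ] (DualNumber ℝ) with φ = (id_E ⊗ μ_n) ψ. -/
open MvPolynomial TensorProduct

/-- The ideal `(X₀², …, X_{n-1}²)` of `ℝ[X₀, …, X_{n-1}]`. -/
noncomputable def weilIdeal (n : ℕ) : Ideal (MvPolynomial (Fin n) ℝ) :=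
  Ideal.span (Set.range fun i : Fin n => (X i : MvPolynomial (Fin n) ℝ) ^ 2)

/-- The Weil algebra `A_n = W_{D^n} = ℝ[X₀, …, X_{n-1}]/(X₀², …, X_{n-1}²)`. -/
noncomputable abbrev WeilA (n : ℕ) : Type :=
  MvPolynomial (Fin n) ℝ ⧸ weilIdeal n

/-- Lifting an assignment of square-zero elements `g : Fin n → B` to an
`ℝ`-algebra homomorphism `A_n →ₐ[ℝ] B`. -/
noncomputable def WeilA.lift {n : ℕ} {B : Type*} [CommRing B] [Algebra ℝ B]
    (g : Fin n → B) (hg : ∀ i, g i ^ 2 = 0) : WeilA n →ₐ[ℝ] B :=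
  Ideal.Quotient.liftₐ (weilIdeal n) (aeval g) (by
    intro a ha
    have h : weilIdeal n ≤ RingHom.ker (aeval g : MvPolynomial (Fin n) ℝ →ₐ[ℝ] B) := by
      rw [weilIdeal, Ideal.span_le]
      rintro p ⟨i, rfl⟩
      simp [RingHom.mem_ker, hg i]
    simpa [RingHom.mem_ker] using h ha)

/-- The class of `X i` squares to zero in `A_n`. -/
theorem WeilA.mk_X_sq (n : ℕ) (i : Fin n) :
    (Ideal.Quotient.mk (weilIdeal n) (X i)) ^ 2 = 0 := by
  rw [← map_pow, Ideal.Quotient.eq_zero_iff_mem]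
  exact Ideal.subset_span ⟨i, rfl⟩

/-- For `n ≥ 1`, the class of `∏ i, X i` squares to zero in `A_n`. -/
theorem WeilA.mk_prod_X_mul_self (n : ℕ) (hn : 1 ≤ n) :
    Ideal.Quotient.mk (weilIdeal n) (∏ i : Fin n, X i) *
      Ideal.Quotient.mk (weilIdeal n) (∏ i : Fin n, X i) = 0 := by
  rw [← map_mul, Ideal.Quotient.eq_zero_iff_mem, ← sq, ← Finset.prod_pow]
  have i0 : Fin n := ⟨0, hn⟩
  obtain ⟨c, hc⟩ :
      (X i0 : MvPolynomial (Fin n) ℝ) ^ 2 ∣ ∏ i : Fin n, (X i : MvPolynomial (Fin n) ℝ) ^ 2 :=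
    Finset.dvd_prod_of_mem _ (Finset.mem_univ i0)
  rw [hc]
  exact Ideal.mul_mem_right _ _ (Ideal.subset_span ⟨i0, rfl⟩)

/-- `ε_j : A_n →ₐ[ℝ] A_n`, induced by `X j ↦ 0` and `X k ↦ X k` for `k ≠ j`. -/
noncomputable def epsAt {n : ℕ} (j : Fin n) : WeilA n →ₐ[ℝ] WeilA n :=
  WeilA.lift (fun k => if k = j then 0 else Ideal.Quotient.mk (weilIdeal n) (X k))
    (by
      intro k
      by_cases h : k = j <;> simp [h, WeilA.mk_X_sq])

/-- `ε_• : A_n →ₐ[ℝ] A_n`, induced by `X i ↦ 0` for all `i`. -/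
noncomputable def epsAll {n : ℕ} : WeilA n →ₐ[ℝ] WeilA n :=
  WeilA.lift (fun _ => 0) (by intro k; simp)

/-- `μ_n : ℝ[ε] →ₐ[ℝ] A_n`, the `ℝ`-algebra homomorphism with `ε ↦ X₀⋯X_{n-1}`. -/
noncomputable def weilMu (n : ℕ) (hn : 1 ≤ n) : DualNumber ℝ →ₐ[ℝ] WeilA n :=
  DualNumber.lift
    ⟨(Algebra.ofId ℝ (WeilA n), Ideal.Quotient.mk (weilIdeal n) (∏ i : Fin n, X i)),
      WeilA.mk_prod_X_mul_self n hn, fun a => Commute.all _ _⟩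

theorem epsAt_mk_monomial {n : ℕ} (j : Fin n) (m : Fin n →₀ ℕ) (a : ℝ) :
    epsAt j (Ideal.Quotient.mk (weilIdeal n) (monomial m a)) =
      if m j = 0 then Ideal.Quotient.mk (weilIdeal n) (monomial m a) else 0 := by
  have h : epsAt j (Ideal.Quotient.mk (weilIdeal n) (monomial m a)) =
      aeval (fun k => if k = j then 0 else Ideal.Quotient.mk (weilIdeal n) (X k))
        (monomial m a) := rfl
  rw [h, aeval_monomial, Finsupp.prod_fintype _ _ (fun i => pow_zero _)]
  split_ifs with hj
  · rw [monomial_eq, map_mul, Finsupp.prod_fintype _ _ (fun i => pow_zero _), map_prod]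
    congr 1
    refine Finset.prod_congr rfl fun i _ => ?_
    by_cases hi : i = j
    · subst hi
      simp [hj]
    · simp [hi]
  · rw [Finset.prod_eq_zero (Finset.mem_univ j), mul_zero]
    simp [hj]

theorem epsAll_mk {n : ℕ} (p : MvPolynomial (Fin n) ℝ) :
    epsAll (Ideal.Quotient.mk (weilIdeal n) p) = algebraMap ℝ (WeilA n) (constantCoeff p) := by
  have h : epsAll (Ideal.Quotient.mk (weilIdeal n) p) =
      aeval (fun _ => (0 : WeilA n)) p := rfl
  rw [h]
  exact aeval_zero' p

theorem epsAt_comp_epsAll {n : ℕ} (j : Fin n) :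
    (epsAt j).toLinearMap ∘ₗ (epsAll (n := n)).toLinearMap = (epsAll (n := n)).toLinearMap := by
  refine LinearMap.ext fun x => ?_
  obtain ⟨p, rfl⟩ := Ideal.Quotient.mk_surjective x
  simp only [LinearMap.comp_apply, AlgHom.toLinearMap_apply, epsAll_mk, AlgHom.commutes]

/-- The composite of the endomorphisms `id - ε_j`, for `j` running through a list. -/
noncomputable def compOneSubEpsAt {n : ℕ} (l : List (Fin n)) : Module.End ℝ (WeilA n) :=
  (l.map fun j => 1 - (epsAt j).toLinearMap).prod

theorem compOneSubEpsAt_cons {n : ℕ} (j : Fin n) (l : List (Fin n)) :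
    compOneSubEpsAt (j :: l) =
      (LinearMap.id - (epsAt j).toLinearMap) ∘ₗ compOneSubEpsAt l := by
  rw [compOneSubEpsAt, List.map_cons, List.prod_cons]
  rfl

theorem compOneSubEpsAt_mk_monomial {n : ℕ} (l : List (Fin n)) (m : Fin n →₀ ℕ) (a : ℝ) :
    compOneSubEpsAt l (Ideal.Quotient.mk (weilIdeal n) (monomial m a)) =
      if ∃ j ∈ l, m j = 0 then 0 else Ideal.Quotient.mk (weilIdeal n) (monomial m a) := by
  induction l with
  | nil => simp [compOneSubEpsAt]
  | cons j l ih =>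
    rw [compOneSubEpsAt_cons, LinearMap.comp_apply, ih]
    by_cases hl : ∃ i ∈ l, m i = 0
    · simp [hl]
    · by_cases hj : m j = 0 <;> simp [hl, hj, epsAt_mk_monomial]

theorem mk_monomial_eq_zero {n : ℕ} {m : Fin n →₀ ℕ} {i : Fin n} (hi : 2 ≤ m i) (a : ℝ) :
    Ideal.Quotient.mk (weilIdeal n) (monomial m a) = 0 := by
  rw [monomial_eq, map_mul, Finsupp.prod_fintype _ _ (fun i => pow_zero _), map_prod,
    Finset.prod_eq_zero (Finset.mem_univ i), mul_zero]
  rw [map_pow]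
  exact pow_eq_zero_of_le hi (WeilA.mk_X_sq n i)

theorem weilMu_apply {n : ℕ} (hn : 1 ≤ n) (z : DualNumber ℝ) :
    weilMu n hn z =
      Ideal.Quotient.mk (weilIdeal n) (C z.fst + C z.snd * ∏ i : Fin n, X i) := by
  rw [weilMu, DualNumber.lift_apply_apply, map_add, map_mul]
  rfl

theorem epsAll_mem_range_weilMu {n : ℕ} (hn : 1 ≤ n) (x : WeilA n) :
    epsAll x ∈ LinearMap.range (weilMu n hn).toLinearMap := by
  obtain ⟨p, rfl⟩ := Ideal.Quotient.mk_surjective x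
  exact ⟨algebraMap ℝ _ (constantCoeff p), by
    rw [epsAll_mk, AlgHom.toLinearMap_apply, AlgHom.commutes]⟩

theorem compOneSubEpsAt_mem_range_weilMu {n : ℕ} (hn : 1 ≤ n) {l : List (Fin n)}
    (hl : ∀ j, j ∈ l) (x : WeilA n) :
    compOneSubEpsAt l x ∈ LinearMap.range (weilMu n hn).toLinearMap := by
  obtain ⟨p, rfl⟩ := Ideal.Quotient.mk_surjective x
  induction p using MvPolynomial.induction_on' with
  | add p q hp hq =>
    rw [map_add, map_add]
    exact add_mem hp hq
  | monomial m a =>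
    rw [compOneSubEpsAt_mk_monomial]
    split_ifs with h
    · exact zero_mem _
    · by_cases h2 : ∃ i, 2 ≤ m i
      · obtain ⟨i, hi⟩ := h2
        rw [mk_monomial_eq_zero hi]
        exact zero_mem _
      · push Not at h h2
        refine ⟨TrivSqZeroExt.inr a, ?_⟩
        rw [AlgHom.toLinearMap_apply, weilMu_apply, monomial_eq,
          Finsupp.prod_fintype _ _ (fun i => pow_zero _)]
        have hm : ∀ i, m i = 1 := fun i => by
          have := h i (hl i)
          have := h2 i
          omega
        simp [hm]

theorem coeff_eq_zero_of_mem_weilIdeal {n : ℕ} {p : MvPolynomial (Fin n) ℝ}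
    (hp : p ∈ weilIdeal n) {m : Fin n →₀ ℕ} (hm : ∀ i, m i ≤ 1) : coeff m p = 0 := by
  have hspan : weilIdeal n = Ideal.span
      ((fun s => monomial s (1 : ℝ)) '' Set.range fun i : Fin n => Finsupp.single i 2) := by
    rw [weilIdeal, ← Set.range_comp]
    simp only [X_pow_eq_monomial, Function.comp_def]
  rw [hspan, mem_ideal_span_monomial_image] at hp
  by_contra hc
  obtain ⟨_, ⟨i, rfl⟩, hi⟩ := hp m (mem_support_iff.mpr hc)
  have h2 := hi i
  simp only [Finsupp.single_eq_same] at h2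
  have := hm i
  omega

theorem weilMu_injective {n : ℕ} (hn : 1 ≤ n) : Function.Injective (weilMu n hn) := by
  rw [injective_iff_map_eq_zero]
  intro z hz
  rw [weilMu_apply, Ideal.Quotient.eq_zero_iff_mem] at hz
  set u : Fin n →₀ ℕ := Finsupp.equivFunOnFinite.symm fun _ => 1 with hu
  have hprod : (∏ i : Fin n, X i : MvPolynomial (Fin n) ℝ) = monomial u 1 := by
    rw [monomial_eq, Finsupp.prod_fintype _ _ (fun i => pow_zero _)]
    simp [hu]
  have hu0 : u ≠ 0 := fun h => by
    simpa [hu] using DFunLike.congr_fun h (⟨0, hn⟩ : Fin n)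
  have h0 := coeff_eq_zero_of_mem_weilIdeal hz (m := 0) (by simp)
  have h1 := coeff_eq_zero_of_mem_weilIdeal hz (m := u) (by simp [hu])
  rw [hprod, coeff_add, coeff_C_mul, coeff_monomial, coeff_C] at h0 h1
  simp only [hu0, hu0.symm, if_true, if_false, mul_zero, mul_one, add_zero, zero_add] at h0 h1
  exact TrivSqZeroExt.ext h0 h1

theorem lTensor_compOneSubEpsAt_cons {n : ℕ} {E : Type*} [AddCommGroup E] [Module ℝ E]
    {φ : E ⊗[ℝ] WeilA n}
    (hφ : ∀ j : Fin n, LinearMap.lTensor E (epsAt j).toLinearMap φ =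
      LinearMap.lTensor E (epsAll (n := n)).toLinearMap φ) (j : Fin n) (l : List (Fin n)) :
    LinearMap.lTensor E (compOneSubEpsAt (j :: l)) φ =
      φ - LinearMap.lTensor E (epsAll (n := n)).toLinearMap φ := by
  induction l generalizing j with
  | nil =>
    rw [compOneSubEpsAt_cons, LinearMap.lTensor_comp_apply, LinearMap.lTensor_sub]
    simp [compOneSubEpsAt, Module.End.one_eq_id, hφ]
  | cons i l ih =>
    rw [compOneSubEpsAt_cons, LinearMap.lTensor_comp_apply, ih, LinearMap.lTensor_sub,
      LinearMap.lTensor_id, LinearMap.sub_apply, LinearMap.id_apply, map_sub, hφ,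
      ← LinearMap.lTensor_comp_apply, epsAt_comp_epsAll, sub_self, sub_zero]

/-- Tensoring with a vector space `E` preserves the limit diagram
`W_D → W_{D^n} ⇉ W_{D^{n-1}}`: any `φ ∈ E ⊗ A_n` equalizing all the pairs
`(id_E ⊗ ε_j, id_E ⊗ ε_•)` factors uniquely through `id_E ⊗ μ_n`. -/
theorem lTensor_weilMu_equalizer (n : ℕ) (hn : 1 ≤ n)
    (E : Type*) [AddCommGroup E] [Module ℝ E] (φ : E ⊗[ℝ] WeilA n)
    (hφ : ∀ j : Fin n,
      LinearMap.lTensor E (epsAt j).toLinearMap φ =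
        LinearMap.lTensor E (epsAll (n := n)).toLinearMap φ) :
    ∃! ψ : E ⊗[ℝ] DualNumber ℝ,
      φ = LinearMap.lTensor E (weilMu n hn).toLinearMap ψ := by
  have hinj : Function.Injective (weilMu n hn).toLinearMap := weilMu_injective hn
  obtain ⟨r, hr⟩ := LinearMap.exists_leftInverse_of_injective _ (LinearMap.ker_eq_bot.mpr hinj)
  set l : List (Fin n) := ⟨0, hn⟩ :: List.finRange n
  set f : WeilA n →ₗ[ℝ] WeilA n := compOneSubEpsAt l + epsAll.toLinearMap
  have hf : (weilMu n hn).toLinearMap ∘ₗ r ∘ₗ f = f := by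
    refine LinearMap.ext fun x => ?_
    obtain ⟨z, hz⟩ : f x ∈ LinearMap.range (weilMu n hn).toLinearMap :=
      add_mem (compOneSubEpsAt_mem_range_weilMu hn
        (fun j => List.mem_cons_of_mem _ (List.mem_finRange j)) x) (epsAll_mem_range_weilMu hn x)
    rw [LinearMap.comp_apply, LinearMap.comp_apply, ← hz, ← LinearMap.comp_apply r, hr,
      LinearMap.id_apply]
  have hfφ : LinearMap.lTensor E f φ = φ := by
    rw [LinearMap.lTensor_add, LinearMap.add_apply, lTensor_compOneSubEpsAt_cons hφ,
      sub_add_cancel]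
  refine ⟨LinearMap.lTensor E (r ∘ₗ f) φ, ?_, fun ψ hψ => ?_⟩
  · beta_reduce
    rw [← LinearMap.lTensor_comp_apply, hf, hfφ]
  · apply Module.Flat.lTensor_preserves_injective_linearMap (M := E) _ hinj
    rw [← hψ, ← LinearMap.lTensor_comp_apply, hf, hfφ]
end

section
/- Let n ≥ 1 and let q ∈ A_n. Then (∀ i : Fin n, ∀ α : ℝ, s_i(α) q = α • q) if and only if there exists c : ℝ with q = c • ∏X; moreover such c is unique. -/
open MvPolynomial

set_option synthInstance.maxHeartbeats 400000 in
/-- `s_i(α) : A_n →ₐ[ℝ] A_n`, induced by `X i ↦ α • X i` and `X k ↦ X k` for `k ≠ i`;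
the algebraic form of scaling the `i`-th infinitesimal coordinate by `α`. -/
noncomputable def scaleAt {n : ℕ} (i : Fin n) (α : ℝ) : WeilA n →ₐ[ℝ] WeilA n :=
  WeilA.lift
    (fun k =>
      if k = i then α • Ideal.Quotient.mk (weilIdeal n) (X k)
      else Ideal.Quotient.mk (weilIdeal n) (X k))
    (by
      intro k
      by_cases h : k = i <;> simp [h, smul_pow, WeilA.mk_X_sq])

/-- The ideal `(X₀², …, X_{n-1}²)` consists of the polynomials without square-free terms. -/
theorem mem_weilIdeal_iff {n : ℕ} (p : MvPolynomial (Fin n) ℝ) :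
    p ∈ weilIdeal n ↔ ∀ m : Fin n →₀ ℕ, (∀ i, m i ≤ 1) → coeff m p = 0 := by
  have h : weilIdeal n = Ideal.span ((fun s => monomial s (1 : ℝ)) ''
      Set.range fun i : Fin n => Finsupp.single i 2) := by
    rw [weilIdeal, ← Set.range_comp]
    simp only [Function.comp_def, X_pow_eq_monomial]
  rw [h, mem_ideal_span_monomial_image]
  refine forall_congr' fun m => ?_
  simp only [Set.exists_range_iff, Finsupp.single_le_iff, mem_support_iff]
  constructor
  · intro H hm
    by_contra hc
    obtain ⟨i, hi⟩ := H hc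
    have := hm i
    omega
  · intro H hc
    by_contra! hm
    exact hc (H fun i => Nat.le_of_lt_succ (hm i))

/-- Substituting `α * X i` for `X i` multiplies the coefficient of a monomial by `α` to the
power of its degree in `X i`. -/
theorem coeff_aeval_scale {n : ℕ} (i : Fin n) (α : ℝ) (p : MvPolynomial (Fin n) ℝ)
    (m : Fin n →₀ ℕ) :
    coeff m (aeval (fun k => if k = i then α • (X k : MvPolynomial (Fin n) ℝ) else X k) p) =
      α ^ m i * coeff m p := by
  induction p using MvPolynomial.induction_on' with
  | monomial s a =>
    have h : aeval (fun k => if k = i then α • (X k : MvPolynomial (Fin n) ℝ) else X k)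
        (monomial s a) = α ^ s i • monomial s a := by
      have hk (k : Fin n) : (if k = i then α • (X k : MvPolynomial (Fin n) ℝ) else X k) ^ s k =
          (if k = i then C (α ^ s k) else 1) * X k ^ s k := by
        split_ifs <;> simp [smul_eq_C_mul, mul_pow]
      rw [aeval_monomial, Finsupp.prod_fintype _ _ (by simp), monomial_eq,
        Finsupp.prod_fintype _ _ (by simp), Finset.prod_congr rfl fun k _ => hk k,
        Finset.prod_mul_distrib, Finset.prod_ite_eq', if_pos (Finset.mem_univ i),
        smul_eq_C_mul, algebraMap_eq]
      ring
    rw [h, coeff_smul, smul_eq_mul, coeff_monomial]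
    split_ifs with hs
    · rw [hs]
    · simp
  | add p q hp hq => simp only [map_add, coeff_add, hp, hq, mul_add]

/-- `scaleAt i α` is induced by the substitution of `α * X i` for `X i`. -/
theorem scaleAt_mk {n : ℕ} (i : Fin n) (α : ℝ) (p : MvPolynomial (Fin n) ℝ) :
    scaleAt i α (Ideal.Quotient.mk (weilIdeal n) p) = Ideal.Quotient.mk (weilIdeal n)
      (aeval (fun k => if k = i then α • (X k : MvPolynomial (Fin n) ℝ) else X k) p) := by
  change aeval _ p = (Ideal.Quotient.mkₐ ℝ (weilIdeal n)) (aeval _ p)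
  rw [← AlgHom.comp_apply, comp_aeval]
  congr 2
  funext k
  split_ifs
  · exact (map_smul (Ideal.Quotient.mkₐ ℝ (weilIdeal n)) α (X k)).symm
  · rfl

theorem prod_X_eq_monomial (n : ℕ) : (∏ i : Fin n, X i : MvPolynomial (Fin n) ℝ) =
    monomial (Finsupp.equivFunOnFinite.symm 1) 1 := by
  rw [monomial_eq, Finsupp.prod_fintype _ _ (by simp)]
  simp

theorem mk_smul_weilIdeal {n : ℕ} (c : ℝ) (p : MvPolynomial (Fin n) ℝ) :
    c • Ideal.Quotient.mk (weilIdeal n) p = Ideal.Quotient.mk (weilIdeal n) (c • p) :=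
  rfl

/-- An element `q ∈ A_n` is `n`-homogeneous (`s_i(α) q = α • q` for all `i`, `α`) iff it
is a (unique) real scalar multiple of the class of `X₀⋯X_{n-1}`. -/
theorem weilA_homogeneous_iff_smul_prod_X (n : ℕ) (hn : 1 ≤ n) (q : WeilA n) :
    (∀ (i : Fin n) (α : ℝ), scaleAt i α q = α • q) ↔
      ∃! c : ℝ, q = c • Ideal.Quotient.mk (weilIdeal n) (∏ i : Fin n, X i) := by
  obtain ⟨p, rfl⟩ := Ideal.Quotient.mk_surjective q
  simp only [scaleAt_mk, mk_smul_weilIdeal, Ideal.Quotient.mk_eq_mk_iff_sub_mem,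
    mem_weilIdeal_iff, prod_X_eq_monomial, coeff_sub, coeff_smul, coeff_aeval_scale,
    coeff_monomial, smul_eq_mul, sub_eq_zero]
  constructor
  · intro H
    refine ⟨coeff (Finsupp.equivFunOnFinite.symm 1) p, fun m hm => ?_, fun c hc => ?_⟩
    · split_ifs with h
      · rw [h, mul_one]
      · obtain ⟨i, hi⟩ : ∃ i, m i ≠ 1 := by
          by_contra! h1
          exact h (Finsupp.ext fun i => by simp [h1 i])
        have h0 : m i = 0 := by have := hm i; omega
        simpa [h0] using H i 0 m hm
    · simpa using (hc (Finsupp.equivFunOnFinite.symm 1) (by simp)).symm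
  · rintro ⟨c, hc, -⟩ i α m hm
    rw [hc m hm]
    split_ifs with h
    · simp [← h]
    · simp
end
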